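/- Let X be a first countable, locally compact, paracompact Hausdorff topological space and let f : X → X be a topologically Anosov homeomorphism. Then there exist a neighborhood B of Δ_X, a symmetric neighborhood D of Δ_X, and a map t : D → X, continuous on D (as a subspace of X × X), such that: (1) for any x, y ∈ X, the set W^s_B(x) ∩ W^u_B(y) contains at most one point; (2) for every (x,y) ∈ D, W^s_B(x) ∩ W^u_B(y) = {t(x,y)}; (3) for every x ∈ X, W^s_B(x) ∩ D[x] = {y ∈ X : (x,y) ∈ D and y = t(x,y)}; (4) for every x ∈ X, W^u_B(x) ∩ D[x] = {y ∈ X : (y,x) ∈ D and y = t(y,x)}. -/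

import Mathlib

open Set Topology

namespace TopAnosovPaper

variable {X Y : Type*}

section Defs

variable [TopologicalSpace X]

/-- The `n`-th iterate (n ∈ ℤ) of a homeomorphism, as a function. -/
def iter (f : X ≃ₜ X) (n : ℤ) : X → X := ⇑(f.toEquiv ^ n)

/-- `N` is an expansive neighborhood for `f`: a closed neighborhood of the
diagonal such that any two distinct points are eventually separated by `F = f × f`. -/
def IsExpansiveNbhd (f : X ≃ₜ X) (N : Set (X × X)) : Prop :=
  IsClosed N ∧ N ∈ nhdsSet (Set.diagonal X) ∧
    ∀ x y : X, x ≠ y → ∃ n : ℤ, (iter f n x, iter f n y) ∉ N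

/-- `f` is topologically expansive. -/
def TopExpansive (f : X ≃ₜ X) : Prop := ∃ N : Set (X × X), IsExpansiveNbhd f N

/-- A `D`-pseudo-orbit: a bi-infinite sequence with `(f x_{i-1}, x_i) ∈ D`. -/
def IsPseudoOrbit (f : X ≃ₜ X) (D : Set (X × X)) (x : ℤ → X) : Prop :=
  ∀ i : ℤ, (f (x (i - 1)), x i) ∈ D

/-- `y` `E`-traces the bi-infinite sequence `x`. -/
def Traces (f : X ≃ₜ X) (E : Set (X × X)) (y : X) (x : ℤ → X) : Prop :=
  ∀ i : ℤ, (iter f i y, x i) ∈ E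

/-- `f` has the topological shadowing property. -/
def TopShadowing (f : X ≃ₜ X) : Prop :=
  ∀ E ∈ nhdsSet (Set.diagonal X), ∃ D ∈ nhdsSet (Set.diagonal X),
    ∀ x : ℤ → X, IsPseudoOrbit f D x → ∃ y : X, Traces f E y x

/-- `f` is topologically Anosov: expansive with the shadowing property. -/
def TopAnosov (f : X ≃ₜ X) : Prop := TopExpansive f ∧ TopShadowing f

/-- An `A`-chain from `x` to `y` (of length `n ≥ 1`). -/
def IsChainFromTo (f : X ≃ₜ X) (A : Set (X × X)) (x y : X) : Prop :=
  ∃ n : ℕ, 1 ≤ n ∧ ∃ c : ℕ → X, c 0 = x ∧ c n = y ∧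
    ∀ i : ℕ, 1 ≤ i → i ≤ n → (f (c (i - 1)), c i) ∈ A

/-- `x ∼ y`: for every neighborhood `A` of the diagonal there is an `A`-chain
from `x` to `y` and one from `y` to `x`. -/
def ChainRel (f : X ≃ₜ X) (x y : X) : Prop :=
  ∀ A ∈ nhdsSet (Set.diagonal X), IsChainFromTo f A x y ∧ IsChainFromTo f A y x

/-- The chain recurrent set. -/
def CR (f : X ≃ₜ X) : Set X := {x | ChainRel f x x}

/-- `R` is a chain component: an equivalence class of `∼` restricted to `CR f`. -/
def IsChainComponent (f : X ≃ₜ X) (R : Set X) : Prop :=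
  ∃ x ∈ CR f, R = {y | y ∈ CR f ∧ ChainRel f x y}

/-- The non-wandering set of `f`. -/
def NonWandering (f : X ≃ₜ X) : Set X :=
  {x | ∀ G : Set X, IsOpen G → x ∈ G → ∃ n : ℕ, 0 < n ∧ (iter f n '' G ∩ G).Nonempty}

/-- `x` is a periodic point of `f`. -/
def Periodic (f : X ≃ₜ X) (x : X) : Prop := ∃ n : ℕ, 0 < n ∧ iter f n x = x

/-- The set of periodic points of `f`. -/
def Per (f : X ≃ₜ X) : Set X := {x | Periodic f x}

/-- A relation `M ⊆ X × X` is proper if `M[S]` is compact for every compact `S`. -/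
def IsProperRel (M : Set (X × X)) : Prop :=
  ∀ S : Set X, IsCompact S → IsCompact {y : X | ∃ x ∈ S, (x, y) ∈ M}

/-- A set `U ⊆ X × X` is wide if `U ∪ (S × X) = X × X` for some compact `S`. -/
def IsWide (U : Set (X × X)) : Prop :=
  ∃ S : Set X, IsCompact S ∧ U ∪ (S ×ˢ (Set.univ : Set X)) = Set.univ

/-- `E` is symmetric. -/
def SymmRel (E : Set (X × X)) : Prop := ∀ p : X × X, p ∈ E → (p.2, p.1) ∈ E

/-- `E² = {(x,y) : ∃ z, (x,z) ∈ E ∧ (z,y) ∈ E}`. -/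
def sq (E : Set (X × X)) : Set (X × X) := {p : X × X | ∃ z : X, (p.1, z) ∈ E ∧ (z, p.2) ∈ E}

/-- The local stable set of `x` relative to `B`. -/
def WsLoc (f : X ≃ₜ X) (B : Set (X × X)) (x : X) : Set X :=
  {y | ∀ i : ℤ, 0 ≤ i → (iter f i x, iter f i y) ∈ B}

/-- The local unstable set of `x` relative to `B`. -/
def WuLoc (f : X ≃ₜ X) (B : Set (X × X)) (x : X) : Set X :=
  {y | ∀ i : ℤ, i ≤ 0 → (iter f i x, iter f i y) ∈ B}

/-- The stable set of `x`. -/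
def Ws (f : X ≃ₜ X) (x : X) : Set X :=
  {y | ∀ B ∈ nhdsSet (Set.diagonal X), ∃ n : ℕ, ∀ i : ℤ, (n : ℤ) ≤ i →
    (iter f i x, iter f i y) ∈ B}

/-- The unstable set of `x`. -/
def Wu (f : X ≃ₜ X) (x : X) : Set X :=
  {y | ∀ B ∈ nhdsSet (Set.diagonal X), ∃ n : ℕ, ∀ i : ℤ, i ≤ -(n : ℤ) →
    (iter f i x, iter f i y) ∈ B}

/-- `f` restricted to `R` is topologically transitive: for any nonempty
relatively open subsets `G, H` of `R` there is `n ∈ ℕ` with `f^n(G) ∩ H ≠ ∅`. -/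
def TransitiveOn (f : X ≃ₜ X) (R : Set X) : Prop :=
  ∀ G H : Set X, (∃ U : Set X, IsOpen U ∧ G = U ∩ R) → (∃ V : Set X, IsOpen V ∧ H = V ∩ R) →
    G.Nonempty → H.Nonempty → ∃ n : ℕ, (iter f n '' G ∩ H).Nonempty

/-- `V_N(A)`: pairs whose first `N` forward and backward iterates all lie in `A`. -/
def VN (f : X ≃ₜ X) (A : Set (X × X)) (N : ℕ) : Set (X × X) :=
  {p : X × X | ∀ n : ℤ, |n| ≤ (N : ℤ) → (iter f n p.1, iter f n p.2) ∈ A}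

/-- The `n`-th power (n ∈ ℕ) of a homeomorphism. -/
def hpowNat (f : X ≃ₜ X) : ℕ → X ≃ₜ X
  | 0 => Homeomorph.refl X
  | n + 1 => (hpowNat f n).trans f

/-- The `k`-th power (k ∈ ℤ) of a homeomorphism, as a homeomorphism. -/
def hpow (f : X ≃ₜ X) : ℤ → X ≃ₜ X
  | Int.ofNat n => hpowNat f n
  | Int.negSucc n => (hpowNat f (n + 1)).symm

end Defs

end TopAnosovPaper

namespace TopAnosovPaper

variable {X : Type*}

section Entourages

theorem sq_mono {E F : Set (X × X)} (h : E ⊆ F) : sq E ⊆ sq F :=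
  fun _ ⟨z, h₁, h₂⟩ => ⟨z, h h₁, h h₂⟩

theorem symmRel_inter_preimage_swap (E : Set (X × X)) : SymmRel (E ∩ Prod.swap ⁻¹' E) :=
  fun _ hp => ⟨hp.2, hp.1⟩

variable [TopologicalSpace X]

theorem mem_nhdsSet_diagonal {E : Set (X × X)} :
    E ∈ nhdsSet (diagonal X) ↔ ∀ x, E ∈ 𝓝 (x, x) := by
  rw [nhdsSet_diagonal, Filter.mem_iSup]

theorem mk_self_mem {E : Set (X × X)} (hE : E ∈ nhdsSet (diagonal X)) (x : X) : (x, x) ∈ E :=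
  subset_of_mem_nhdsSet hE (mem_diagonal x)

theorem subset_sq {E : Set (X × X)} (hE : E ∈ nhdsSet (diagonal X)) : E ⊆ sq E :=
  fun p hp => ⟨p.1, mk_self_mem hE p.1, hp⟩

theorem inter_preimage_swap_mem {E : Set (X × X)} (hE : E ∈ nhdsSet (diagonal X)) :
    E ∩ Prod.swap ⁻¹' E ∈ nhdsSet (diagonal X) := by
  rw [mem_nhdsSet_diagonal] at *
  exact fun x => Filter.inter_mem (hE x)
    (continuous_swap.continuousAt.preimage_mem_nhds (by simpa using hE x))

theorem SymmRel.closure {E : Set (X × X)} (hE : SymmRel E) : SymmRel (closure E) := by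
  intro p hp
  exact map_mem_closure (f := Prod.swap) continuous_swap hp hE

theorem closure_subset_sq_sq {E : Set (X × X)} (hE : E ∈ nhdsSet (diagonal X))
    (hs : SymmRel E) : closure E ⊆ sq (sq E) := by
  rintro ⟨a, b⟩ hab
  have hmem : ∀ x, {y | (x, y) ∈ E} ∈ 𝓝 x := fun x =>
    (Continuous.prodMk_right x).continuousAt.preimage_mem_nhds (mem_nhdsSet_diagonal.1 hE x)
  obtain ⟨⟨c, d⟩, ⟨hc, hd⟩, hcd⟩ :=
    mem_closure_iff_nhds.1 hab _ (prod_mem_nhds (hmem a) (hmem b))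
  exact ⟨d, ⟨c, hc, hcd⟩, subset_sq hE (hs _ hd)⟩

variable [ParacompactSpace X] [T2Space X]

/-- In a paracompact Hausdorff space, every open cover has an entourage as Lebesgue number. -/
theorem exists_entourage_subordinate {ι : Type*} (U : ι → Set X) (hU : ∀ i, IsOpen (U i))
    (hcov : ⋃ i, U i = univ) :
    ∃ V ∈ nhdsSet (diagonal X), ∀ x, ∃ i, {y | (x, y) ∈ V} ⊆ U i := by
  obtain ⟨v, hvo, hvc, hvf, hvU⟩ := precise_refinement U hU hcov
  obtain ⟨C, hCc, hCcl, hCv⟩ := exists_iUnion_eq_closed_subset hvo hvf.point_finite hvc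
  have hCf : LocallyFinite C := hvf.subset hCv
  refine ⟨{p | ∀ i, p.1 ∈ C i → p.2 ∈ U i}, mem_nhdsSet_diagonal.2 fun x => ?_, fun x => ?_⟩
  · have hfin : ⋂ i ∈ {i | x ∈ C i}, U i ∈ 𝓝 x :=
      (Filter.biInter_mem (hCf.point_finite x)).2 fun i hi =>
        (hU i).mem_nhds (hvU i (hCv i hi))
    filter_upwards [prod_mem_nhds (hCf.eventually_subset hCcl x) hfin] with p hp i hi
    exact mem_iInter₂.1 hp.2 i (hp.1 hi)
  · obtain ⟨i, hi⟩ := mem_iUnion.1 (hCc.ge (mem_univ x))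
    exact ⟨i, fun y hy => hy i hi⟩

theorem exists_symmRel_sq_subset {E : Set (X × X)} (hE : E ∈ nhdsSet (diagonal X)) :
    ∃ V ∈ nhdsSet (diagonal X), SymmRel V ∧ sq V ⊆ E := by
  have h : ∀ x, ∃ U : Set X, IsOpen U ∧ x ∈ U ∧ U ×ˢ U ⊆ E := fun x =>
    let ⟨U, hU, hx, hUE⟩ := exists_nhds_square (mem_nhdsSet_diagonal.1 hE x)
    ⟨U, hU, hx, hUE⟩
  choose U hUo hxU hUE using h
  obtain ⟨V, hV, hVU⟩ := exists_entourage_subordinate U hUo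
    (iUnion_eq_univ_iff.2 fun x => ⟨x, hxU x⟩)
  refine ⟨_, inter_preimage_swap_mem hV, symmRel_inter_preimage_swap V, ?_⟩
  rintro ⟨a, c⟩ ⟨b, hab, hbc⟩
  obtain ⟨i, hi⟩ := hVU b
  exact hUE i ⟨hi hab.2, hi hbc.1⟩

/-- Closed symmetric entourages form a basis of the neighborhoods of the diagonal. -/
theorem exists_isClosed_symmRel_sq_subset {E : Set (X × X)} (hE : E ∈ nhdsSet (diagonal X)) :
    ∃ V ∈ nhdsSet (diagonal X), IsClosed V ∧ SymmRel V ∧ sq V ⊆ E := by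
  obtain ⟨V₁, hV₁, -, h₁⟩ := exists_symmRel_sq_subset hE
  obtain ⟨V₂, hV₂, -, h₂⟩ := exists_symmRel_sq_subset hV₁
  obtain ⟨V₃, hV₃, hs, h₃⟩ := exists_symmRel_sq_subset hV₂
  exact ⟨closure V₃, Filter.mem_of_superset hV₃ subset_closure, isClosed_closure, hs.closure,
    (sq_mono ((closure_subset_sq_sq hV₃ hs).trans ((sq_mono h₃).trans h₂))).trans h₁⟩

theorem exists_entourage_locally_compact [LocallyCompactSpace X] :
    ∃ V ∈ nhdsSet (diagonal X), ∀ x, ∃ K, IsCompact K ∧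
      ∀ᶠ x' in 𝓝 x, {y | (x', y) ∈ V} ⊆ K := by
  choose K hK hxK using fun x : X => exists_compact_mem_nhds x
  obtain ⟨E, hE, hEK⟩ := exists_entourage_subordinate (fun x => interior (K x))
    (fun _ => isOpen_interior)
    (iUnion_eq_univ_iff.2 fun x => ⟨x, mem_interior_iff_mem_nhds.2 (hxK x)⟩)
  obtain ⟨V, hV, -, hVE⟩ := exists_symmRel_sq_subset hE
  refine ⟨V, hV, fun x => ?_⟩
  obtain ⟨i, hi⟩ := hEK x
  refine ⟨K i, hK i, ?_⟩
  filter_upwards [(Continuous.prodMk_right x).continuousAt.preimage_mem_nhds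
    (mem_nhdsSet_diagonal.1 hV x)] with x' hx' y hy
  exact interior_subset (hi (hVE ⟨x', hx', hy⟩))

end Entourages

section LocalSets

variable [TopologicalSpace X] {f : X ≃ₜ X}

@[simp]
theorem iter_zero (f : X ≃ₜ X) (x : X) : iter f 0 x = x := rfl

theorem apply_iter_sub_one (f : X ≃ₜ X) (n : ℤ) (x : X) : f (iter f (n - 1) x) = iter f n x := by
  have h : f.toEquiv ^ n = f.toEquiv * f.toEquiv ^ (n - 1) := by
    rw [← zpow_one_add, add_sub_cancel]
  simp only [iter, h]
  rfl

theorem continuous_iter (f : X ≃ₜ X) (n : ℤ) : Continuous (iter f n) := by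
  induction n using Int.induction_on with
  | zero => exact continuous_id
  | succ k ih =>
    have h : iter f (k + 1) = f ∘ iter f k := by
      ext x
      simpa using (apply_iter_sub_one f (k + 1) x).symm
    exact h ▸ f.continuous.comp ih
  | pred k ih =>
    have h : iter f (-k - 1) = f.symm ∘ iter f (-k) := by
      ext x
      simp [← apply_iter_sub_one f (-k) x]
    exact h ▸ f.symm.continuous.comp ih

theorem mem_WsLoc_iff {B : Set (X × X)} {x y : X} :
    y ∈ WsLoc f B x ↔ ∀ i : ℤ, 0 ≤ i → (iter f i x, iter f i y) ∈ B :=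
  Iff.rfl

theorem mem_WuLoc_iff {B : Set (X × X)} {x y : X} :
    y ∈ WuLoc f B x ↔ ∀ i : ℤ, i ≤ 0 → (iter f i x, iter f i y) ∈ B :=
  Iff.rfl

theorem mem_WsLoc_self {B : Set (X × X)} (hB : B ∈ nhdsSet (diagonal X)) (x : X) :
    x ∈ WsLoc f B x :=
  fun _ _ => mk_self_mem hB _

theorem mem_WuLoc_self {B : Set (X × X)} (hB : B ∈ nhdsSet (diagonal X)) (x : X) :
    x ∈ WuLoc f B x :=
  fun _ _ => mk_self_mem hB _

theorem isClosed_setOf_mem_WsLoc {B : Set (X × X)} (hB : IsClosed B) :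
    IsClosed {p : X × X | p.2 ∈ WsLoc f B p.1} := by
  simp only [mem_WsLoc_iff, ofPred_forall]
  exact isClosed_iInter fun i => isClosed_iInter fun _ =>
    hB.preimage (((continuous_iter f i).comp continuous_fst).prodMk
      ((continuous_iter f i).comp continuous_snd))

theorem isClosed_setOf_mem_WuLoc {B : Set (X × X)} (hB : IsClosed B) :
    IsClosed {p : X × X | p.2 ∈ WuLoc f B p.1} := by
  simp only [mem_WuLoc_iff, ofPred_forall]
  exact isClosed_iInter fun i => isClosed_iInter fun _ =>
    hB.preimage (((continuous_iter f i).comp continuous_fst).prodMk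
      ((continuous_iter f i).comp continuous_snd))

theorem IsExpansiveNbhd.subsingleton_inter {N B : Set (X × X)} (hN : IsExpansiveNbhd f N)
    (hs : SymmRel B) (hBN : sq B ⊆ N) (x y : X) :
    (WsLoc f B x ∩ WuLoc f B y).Subsingleton := by
  rintro z ⟨hz, hz'⟩ w ⟨hw, hw'⟩
  by_contra hne
  obtain ⟨n, hn⟩ := hN.2.2 z w hne
  rcases le_total 0 n with h | h
  · exact hn (hBN ⟨_, hs _ (hz n h), hw n h⟩)
  · exact hn (hBN ⟨_, hs _ (hz' n h), hw' n h⟩)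

/-- Shadowing the pseudo-orbit that follows the past of `y` and the future of `x`. -/
theorem TopShadowing.exists_nonempty_inter [ParacompactSpace X] [T2Space X]
    (hf : TopShadowing f) {B : Set (X × X)} (hB : B ∈ nhdsSet (diagonal X)) :
    ∃ D ∈ nhdsSet (diagonal X), SymmRel D ∧
      ∀ p ∈ D, (WsLoc f B p.1 ∩ WuLoc f B p.2).Nonempty := by
  obtain ⟨E, hE, hEs, hEB⟩ := exists_symmRel_sq_subset hB
  obtain ⟨A, hA, hshadow⟩ := hf E hE
  refine ⟨_, inter_preimage_swap_mem (Filter.inter_mem hA hE), symmRel_inter_preimage_swap _, ?_⟩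
  rintro ⟨x, y⟩ ⟨-, hyxA, hyxE⟩
  obtain ⟨z, hz⟩ := hshadow (fun i => if 0 ≤ i then iter f i x else iter f i y) fun i => by
    beta_reduce
    rcases lt_trichotomy i 0 with h | rfl | h
    · rw [if_neg (by omega), if_neg (by omega), apply_iter_sub_one]
      exact mk_self_mem hA _
    · rw [if_neg (by omega), if_pos le_rfl, apply_iter_sub_one]
      exact hyxA
    · rw [if_pos (by omega), if_pos (by omega), apply_iter_sub_one]
      exact mk_self_mem hA _
  refine ⟨z, fun i hi => hEB (subset_sq hE ?_), fun i hi => ?_⟩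
  · simpa [hi] using hEs _ (hz i)
  · rcases hi.lt_or_eq with h | rfl
    · simpa [not_le.2 h] using hEB (subset_sq hE (hEs _ (hz i)))
    · exact hEB ⟨x, hyxE, by simpa using hEs _ (hz 0)⟩

/-- A selection of the intersections of local stable and unstable sets is continuous. -/
theorem continuousOn_of_mem_inter {B D : Set (X × X)} {t : X × X → X} (hB : IsClosed B)
    (hK : ∀ x, ∃ K, IsCompact K ∧ ∀ᶠ x' in 𝓝 x, {y | (x', y) ∈ B} ⊆ K)
    (hsub : ∀ x y, (WsLoc f B x ∩ WuLoc f B y).Subsingleton)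
    (ht : ∀ p ∈ D, t p ∈ WsLoc f B p.1 ∩ WuLoc f B p.2) : ContinuousOn t D := by
  intro p hp
  obtain ⟨K, hKc, hKp⟩ := hK p.1
  refine hKc.tendsto_nhds_of_unique_mapClusterPt (l := 𝓝[D] p) ?_ fun z _ hz => ?_
  · filter_upwards [self_mem_nhdsWithin, nhdsWithin_le_nhds
      (continuous_fst.continuousAt.eventually hKp)] with q hq hqK
    exact hqK ((ht q hq).1 0 le_rfl)
  · obtain ⟨u, hu, huz⟩ := mapClusterPt_iff_ultrafilter.1 hz
    have hD : ∀ᶠ q in (u : Filter (X × X)), q ∈ D := hu self_mem_nhdsWithin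
    have hup : Filter.Tendsto id (u : Filter (X × X)) (𝓝 p) := hu.trans nhdsWithin_le_nhds
    refine hsub p.1 p.2 ⟨?_, ?_⟩ (ht p hp)
    · exact (isClosed_setOf_mem_WsLoc hB).mem_of_tendsto
        (((continuous_fst.tendsto p).comp hup).prodMk_nhds huz) (hD.mono fun q hq => (ht q hq).1)
    · exact (isClosed_setOf_mem_WuLoc hB).mem_of_tendsto
        (((continuous_snd.tendsto p).comp hup).prodMk_nhds huz) (hD.mono fun q hq => (ht q hq).2)

end LocalSets

end TopAnosovPaper

open TopAnosovPaper

/-- Local product structure for topologically Anosov homeomorphisms. -/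
theorem local_product_structure {X : Type*} [TopologicalSpace X]
    [FirstCountableTopology X] [LocallyCompactSpace X] [ParacompactSpace X] [T2Space X]
    (f : X ≃ₜ X) (hf : TopAnosov f) :
    ∃ B ∈ nhdsSet (Set.diagonal X), ∃ D ∈ nhdsSet (Set.diagonal X), ∃ t : X × X → X,
      SymmRel D ∧ ContinuousOn t D ∧
      (∀ x y : X, Set.Subsingleton (WsLoc f B x ∩ WuLoc f B y)) ∧
      (∀ p : X × X, p ∈ D → WsLoc f B p.1 ∩ WuLoc f B p.2 = {t p}) ∧
      (∀ x : X, WsLoc f B x ∩ {y : X | (x, y) ∈ D} =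
        {y : X | (x, y) ∈ D ∧ y = t (x, y)}) ∧
      (∀ x : X, WuLoc f B x ∩ {y : X | (x, y) ∈ D} =
        {y : X | (y, x) ∈ D ∧ y = t (y, x)}) := by
  obtain ⟨⟨N, hN⟩, hsh⟩ := hf
  obtain ⟨V, hV, hVK⟩ := exists_entourage_locally_compact (X := X)
  obtain ⟨B, hB, hBc, hBs, hBNV⟩ :=
    exists_isClosed_symmRel_sq_subset (Filter.inter_mem hN.2.1 hV)
  have hBV : B ⊆ V := (subset_sq hB).trans (hBNV.trans inter_subset_right)
  have hsub := hN.subsingleton_inter hBs (hBNV.trans inter_subset_left)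
  obtain ⟨D, hD, hDs, hne⟩ := hsh.exists_nonempty_inter hB
  have hex : ∀ p : X × X, ∃ z, p ∈ D → z ∈ WsLoc f B p.1 ∩ WuLoc f B p.2 := fun p => by
    by_cases hp : p ∈ D
    · exact (hne p hp).imp fun _ hz _ => hz
    · exact ⟨p.1, fun h => absurd h hp⟩
  choose t ht using hex
  refine ⟨B, hB, D, hD, t, hDs, continuousOn_of_mem_inter hBc (fun x => ?_) hsub ht, hsub,
    fun p hp => (hsub _ _).eq_singleton_of_mem (ht p hp), fun x => ?_, fun x => ?_⟩
  · obtain ⟨K, hK, hxK⟩ := hVK x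
    exact ⟨K, hK, hxK.mono fun x' hx' y hy => hx' (hBV hy)⟩
  · ext y
    constructor
    · rintro ⟨hy, hxy⟩
      exact ⟨hxy, hsub x y ⟨hy, mem_WuLoc_self hB y⟩ (ht _ hxy)⟩
    · rintro ⟨hxy, hy⟩
      exact ⟨hy ▸ (ht _ hxy).1, hxy⟩
  · ext y
    constructor
    · rintro ⟨hy, hxy⟩
      have hyx : (y, x) ∈ D := hDs _ hxy
      exact ⟨hyx, hsub y x ⟨mem_WsLoc_self hB y, hy⟩ (ht _ hyx)⟩
    · rintro ⟨hyx, hy⟩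
      exact ⟨hy ▸ (ht _ hyx).2, hDs _ hyx⟩
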